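/- Let h : Θ × Ξ → [0, K], fix α > 0, β > 0, probability measures p₀ on Ξ and the empirical measure p_emp of a sample ξ_1, …, ξ_n, and let φ_β(t) = β·exp(t/β) − β. Let Q be a probability measure on probability measures on Ξ with ∫ R_p(θ) dQ(p) = (n/(α+n))·R_{p_emp}(θ) + (α/(α+n))·R_{p₀}(θ) for all θ, and set V(θ) = ∫ φ_β(R_p(θ)) dQ(p). Then sup_{θ∈Θ} |V(θ) − R_{p_emp}(θ)| ≤ e^{K/β} · (α/(α+n)) · K + (K²/2) · (e^{K/β}/β). In particular, this bound tends to 0 as α → 0 and β → ∞. -/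

import Mathlib

open MeasureTheory Filter Topology

/-- The space of probability measures, as a subtype of measures, inherits the σ-algebra of
the space of measures. -/
instance probabilityMeasureMeasurableSpace {Ω : Type*} [MeasurableSpace Ω] :
    MeasurableSpace (ProbabilityMeasure Ω) :=
  Subtype.instMeasurableSpace

/-- Second-order Taylor upper bound for the exponential on the nonnegative half-line. -/
lemma exp_le_one_add_add_sq_mul_exp {x : ℝ} (hx : 0 ≤ x) :
    Real.exp x ≤ 1 + x + x ^ 2 / 2 * Real.exp x := by
  have hderiv : ∀ y : ℝ, HasDerivAt (fun y => (1 + y) * Real.exp (-y) + y ^ 2 / 2)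
      (y * (1 - Real.exp (-y))) y := by
    intro y
    have h₁ : HasDerivAt (fun y : ℝ => Real.exp (-y)) (Real.exp (-y) * (-1)) y :=
      (hasDerivAt_neg y).exp
    have h₂ := (((hasDerivAt_id y).const_add 1).mul h₁).add ((hasDerivAt_pow 2 y).div_const 2)
    refine h₂.congr_deriv ?_
    simp
    ring
  have hmono : MonotoneOn (fun y : ℝ => (1 + y) * Real.exp (-y) + y ^ 2 / 2) (Set.Ici 0) := by
    refine monotoneOn_of_deriv_nonneg (convex_Ici 0)
      (fun y _ => (hderiv y).continuousAt.continuousWithinAt)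
      (fun y _ => (hderiv y).differentiableAt.differentiableWithinAt) fun y hy => ?_
    rw [interior_Ici, Set.mem_Ioi] at hy
    rw [(hderiv y).deriv]
    have : Real.exp (-y) ≤ 1 := Real.exp_le_one_iff.2 (by linarith)
    exact mul_nonneg hy.le (by linarith)
  have h₀ := hmono Set.self_mem_Ici (Set.mem_Ici.2 hx) hx
  simp only [add_zero, neg_zero, Real.exp_zero, mul_one] at h₀
  have h₁ : Real.exp (-x) * Real.exp x = 1 := by rw [← Real.exp_add]; simp
  nlinarith [mul_le_mul_of_nonneg_right h₀ (Real.exp_pos x).le]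

/-- The function `t ↦ β e^{t/β} - β` exceeds the identity on `[0, K]` by at most
`K² / 2 · e^{K/β} / β`. -/
lemma abs_mul_exp_div_sub_sub_le {K β t : ℝ} (hβ : 0 < β) (ht : t ∈ Set.Icc 0 K) :
    |β * Real.exp (t / β) - β - t| ≤ K ^ 2 / 2 * (Real.exp (K / β) / β) := by
  have hlow : t ≤ β * Real.exp (t / β) - β := by
    have h₁ := mul_le_mul_of_nonneg_left (Real.add_one_le_exp (t / β)) hβ.le
    rw [mul_add, mul_div_cancel₀ t hβ.ne'] at h₁
    linarith
  have hup : β * Real.exp (t / β) - β - t ≤ t ^ 2 / 2 * (Real.exp (t / β) / β) := by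
    have h₁ := mul_le_mul_of_nonneg_left
      (exp_le_one_add_add_sq_mul_exp (div_nonneg ht.1 hβ.le)) hβ.le
    have h₂ : β * (1 + t / β + (t / β) ^ 2 / 2 * Real.exp (t / β))
        = β + t + t ^ 2 / 2 * (Real.exp (t / β) / β) := by
      field_simp
    linarith
  rw [abs_of_nonneg (by linarith)]
  refine hup.trans ?_
  have := ht.1
  have := ht.2
  gcongr

/-- The mean of a `[0, K]`-valued function under a probability measure lies in `[0, K]`. -/
lemma integral_mem_Icc_zero {Ω : Type*} [MeasurableSpace Ω] (μ : Measure Ω)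
    [IsProbabilityMeasure μ] {K : ℝ} {f : Ω → ℝ} (hf : ∀ x, f x ∈ Set.Icc 0 K)
    (hmeas : Measurable f) : ∫ x, f x ∂μ ∈ Set.Icc 0 K := by
  refine ⟨integral_nonneg fun x => (hf x).1, ?_⟩
  have hint : Integrable f μ := Integrable.of_mem_Icc 0 K hmeas.aemeasurable (ae_of_all _ hf)
  simpa using integral_mono hint (integrable_const K) fun x => (hf x).2

/-- Integrating a fixed nonnegative measurable function is measurable in the probability
measure. -/
lemma measurable_integral_probabilityMeasure {Ω : Type*} [MeasurableSpace Ω] {f : Ω → ℝ}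
    (hf : ∀ x, 0 ≤ f x) (hmeas : Measurable f) :
    Measurable fun p : ProbabilityMeasure Ω => ∫ x, f x ∂(p : Measure Ω) := by
  have heq : (fun p : ProbabilityMeasure Ω => ∫ x, f x ∂(p : Measure Ω))
      = fun p : ProbabilityMeasure Ω => (∫⁻ x, ENNReal.ofReal (f x) ∂(p : Measure Ω)).toReal := by
    funext p
    exact integral_eq_lintegral_of_nonneg_ae (ae_of_all _ hf) hmeas.aestronglyMeasurable
  rw [heq]
  exact ((Measure.measurable_lintegral hmeas.ennreal_ofReal).comp
    measurable_subtype_coe).ennreal_toReal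

/-- **Uniform closeness of the smooth criterion to the empirical risk** (step in the proof of
Proposition `pro:asymp_normality`).  With `φ_β(t) = β·e^{t/β} − β` and `Q` a probability
measure over probability measures on `Ξ` whose mean risk is the predictive mixture
`(n/(α+n))·R_emp + (α/(α+n))·R_{p₀}`, the criterion `V(θ) = ∫ φ_β(R_p(θ)) dQ(p)` satisfies
`sup_θ |V(θ) − R_emp(θ)| ≤ e^{K/β}·(α/(α+n))·K + (K²/2)·(e^{K/β}/β)`; moreover this bound
tends to `0` as `α → 0⁺` and `β → ∞`. -/
theorem smooth_criterion_close_to_empirical_risk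
    {Θ : Type*} {Ξ : Type*} [MeasurableSpace Ξ]
    (K : ℝ) (hK : 0 < K)
    (h : Θ → Ξ → ℝ) (hval : ∀ θ ξ, h θ ξ ∈ Set.Icc 0 K) (hmeas : ∀ θ, Measurable (h θ))
    (n : ℕ) (hn : 0 < n) (ξs : Fin n → Ξ)
    (α β : ℝ) (hα : 0 < α) (hβ : 0 < β)
    (p₀ : Measure Ξ) [IsProbabilityMeasure p₀]
    (Q : Measure (ProbabilityMeasure Ξ)) [IsProbabilityMeasure Q]
    (hQmean : ∀ θ : Θ,
      (∫ p : ProbabilityMeasure Ξ, ∫ ξ, h θ ξ ∂(p : Measure Ξ) ∂Q)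
        = ((n : ℝ) / (α + n)) * ((1 / n) * ∑ i, h θ (ξs i))
          + (α / (α + n)) * ∫ ξ, h θ ξ ∂p₀) :
    (∀ θ : Θ,
      |(∫ p : ProbabilityMeasure Ξ,
            (β * Real.exp ((∫ ξ, h θ ξ ∂(p : Measure Ξ)) / β) - β) ∂Q)
          - (1 / n) * ∑ i, h θ (ξs i)|
        ≤ Real.exp (K / β) * (α / (α + n)) * K + K ^ 2 / 2 * (Real.exp (K / β) / β))
    ∧ Tendsto
        (fun q : ℝ × ℝ =>
          Real.exp (K / q.2) * (q.1 / (q.1 + n)) * K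
            + K ^ 2 / 2 * (Real.exp (K / q.2) / q.2))
        ((𝓝[>] (0 : ℝ)) ×ˢ (atTop : Filter ℝ)) (𝓝 0) := by
  have hn' : (0 : ℝ) < n := Nat.cast_pos.2 hn
  refine ⟨fun θ => ?_, ?_⟩
  · have hR : ∀ p : ProbabilityMeasure Ξ, ∫ ξ, h θ ξ ∂(p : Measure Ξ) ∈ Set.Icc 0 K :=
      fun p => integral_mem_Icc_zero _ (hval θ) (hmeas θ)
    have hRmeas := measurable_integral_probabilityMeasure (fun ξ => (hval θ ξ).1) (hmeas θ)
    have hRint : Integrable (fun p : ProbabilityMeasure Ξ => ∫ ξ, h θ ξ ∂(p : Measure Ξ)) Q :=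
      Integrable.of_mem_Icc 0 K hRmeas.aemeasurable (ae_of_all _ hR)
    have hφint : Integrable (fun p : ProbabilityMeasure Ξ =>
        β * Real.exp ((∫ ξ, h θ ξ ∂(p : Measure Ξ)) / β) - β) Q := by
      refine Integrable.of_mem_Icc (β * Real.exp (0 / β) - β) (β * Real.exp (K / β) - β)
        (((hRmeas.div_const β).exp.const_mul β).sub_const β).aemeasurable
        (ae_of_all _ fun p => ⟨?_, ?_⟩)
      · have := (hR p).1
        gcongr
      · have := (hR p).2
        gcongr
    have hV : |(∫ p : ProbabilityMeasure Ξ,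
          (β * Real.exp ((∫ ξ, h θ ξ ∂(p : Measure Ξ)) / β) - β) ∂Q)
        - ∫ p : ProbabilityMeasure Ξ, ∫ ξ, h θ ξ ∂(p : Measure Ξ) ∂Q|
        ≤ K ^ 2 / 2 * (Real.exp (K / β) / β) := by
      rw [← integral_sub hφint hRint, ← Real.norm_eq_abs]
      refine (norm_integral_le_of_norm_le_const (ae_of_all _ fun p =>
        abs_mul_exp_div_sub_sub_le hβ (hR p))).trans_eq ?_
      simp
    have hp₀ := integral_mem_Icc_zero p₀ (hval θ) (hmeas θ)
    have hemp : (1 / (n : ℝ)) * ∑ i, h θ (ξs i) ∈ Set.Icc 0 K := by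
      refine ⟨mul_nonneg (by positivity) (Finset.sum_nonneg fun i _ => (hval θ _).1), ?_⟩
      rw [one_div_mul_eq_div, div_le_iff₀ hn', mul_comm]
      simpa using Finset.sum_le_card_nsmul Finset.univ (fun i => h θ (ξs i)) K
        fun i _ => (hval θ _).2
    have hmean : |(∫ p : ProbabilityMeasure Ξ, ∫ ξ, h θ ξ ∂(p : Measure Ξ) ∂Q)
        - (1 / n) * ∑ i, h θ (ξs i)| ≤ Real.exp (K / β) * (α / (α + n)) * K := by
      have heq : (∫ p : ProbabilityMeasure Ξ, ∫ ξ, h θ ξ ∂(p : Measure Ξ) ∂Q)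
          - (1 / n) * ∑ i, h θ (ξs i)
          = α / (α + n) * ((∫ ξ, h θ ξ ∂p₀) - (1 / n) * ∑ i, h θ (ξs i)) := by
        rw [hQmean θ]
        field_simp
        ring
      have hw : 0 ≤ α / (α + n) := by positivity
      rw [heq, abs_mul, abs_of_nonneg hw]
      refine mul_le_mul (le_mul_of_one_le_left hw (Real.one_le_exp (by positivity))) ?_
        (abs_nonneg _) (by positivity)
      rw [abs_le]
      constructor <;> linarith [hp₀.1, hp₀.2, hemp.1, hemp.2]
    exact (abs_sub_le _ _ _).trans ((add_le_add hV hmean).trans_eq (add_comm _ _))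
  · have hfst : Tendsto (fun q : ℝ × ℝ => q.1) ((𝓝[>] (0 : ℝ)) ×ˢ (atTop : Filter ℝ)) (𝓝 0) :=
      tendsto_fst.mono_right nhdsWithin_le_nhds
    have hsnd : Tendsto (fun q : ℝ × ℝ => q.2) ((𝓝[>] (0 : ℝ)) ×ˢ (atTop : Filter ℝ)) atTop :=
      tendsto_snd
    have hexp : Tendsto (fun q : ℝ × ℝ => Real.exp (K / q.2))
        ((𝓝[>] (0 : ℝ)) ×ˢ (atTop : Filter ℝ)) (𝓝 1) := by
      simpa using (hsnd.const_div_atTop K).rexp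
    have hweight : Tendsto (fun q : ℝ × ℝ => q.1 / (q.1 + n))
        ((𝓝[>] (0 : ℝ)) ×ˢ (atTop : Filter ℝ)) (𝓝 0) := by
      simpa [Pi.div_def] using hfst.div (hfst.add_const (n : ℝ)) (by simpa using hn'.ne')
    simpa using ((hexp.mul hweight).mul_const K).add
      ((hexp.div_atTop hsnd).const_mul (K ^ 2 / 2))
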